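/- Let B = conv{(1,0,0), (0,1,0), (−1,−1,0)} ⊆ ℝ³, let u ∈ ℤ³ with u₃ ≠ 0, and suppose the prism P = conv(B ∪ (B + u)) belongs to 𝓜³, i.e., P is a maximal lattice-free integral polytope. Then there exist a matrix U ∈ ℤ^{3×3} with |det U| = 1 and a vector v ∈ ℤ³ such that P = U·M₁₀ + v, where M₁₀ = conv(B ∪ (B + (1,2,3))). -/

import Mathlib

open Set

/-- The set of integer points `ℤ^d` inside `ℝ^d`. -/
def intPts (d : ℕ) : Set (Fin d → ℝ) := {x | ∀ i, ∃ z : ℤ, x i = (z : ℝ)}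

/-- The lattice `Λ = s·ℤ^d` inside `ℝ^d`. -/
def sLat (d s : ℕ) : Set (Fin d → ℝ) := {x | ∀ i, ∃ z : ℤ, x i = (s : ℝ) * (z : ℝ)}

/-- A polyhedron: a finite intersection of closed halfspaces. -/
def IsPolyhedron {d : ℕ} (P : Set (Fin d → ℝ)) : Prop :=
  ∃ (n : ℕ) (A : Fin n → Fin d → ℝ) (b : Fin n → ℝ),
    P = {x | ∀ i, (∑ j, A i j * x j) ≤ b i}

/-- An integral set: it equals the convex hull of its integer points. -/
def IsIntegralPoly {d : ℕ} (P : Set (Fin d → ℝ)) : Prop :=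
  P = convexHull ℝ (P ∩ intPts d)

/-- The affine map `x ↦ U·x + t` with integer matrix `U` and translation `t : ℝ^d`. -/
noncomputable def affMap {d : ℕ} (U : Matrix (Fin d) (Fin d) ℤ) (t : Fin d → ℝ)
    (x : Fin d → ℝ) : Fin d → ℝ := fun i => (∑ j, (U i j : ℝ) * x j) + t i

/-- Membership in `𝓜³`: a maximal lattice-free integral polytope in `ℝ³`, i.e. a bounded
integral polyhedron with nonempty interior, whose interior contains no integer point, and
which is not properly contained in any convex set whose interior contains no integer point. -/
def MemM3 (P : Set (Fin 3 → ℝ)) : Prop :=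
  IsPolyhedron P ∧ Bornology.IsBounded P ∧ IsIntegralPoly P ∧ (interior P).Nonempty ∧
    interior P ∩ intPts 3 = ∅ ∧
    ∀ K : Set (Fin 3 → ℝ), Convex ℝ K → interior K ∩ intPts 3 = ∅ → P ⊆ K → P = K

def B10 : Set (Fin 3 → ℝ) :=
  convexHull ℝ ({![1,0,0], ![0,1,0], ![-1,-1,0]} : Set (Fin 3 → ℝ))

def M10 : Set (Fin 3 → ℝ) :=
  convexHull ℝ (B10 ∪ (fun x => x + ![1,2,3]) '' B10)

/-- A planar translate of the triangle `x + y ≤ 1, -2x + y ≤ 1, x - 2y ≤ 1` contains an integer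
point in its interior unless the translation vector is `±(1/3, 2/3)` modulo `ℤ²`. The translation
vector is `(A / h, B / h)`. -/
lemma exists_int_in_translate_or {h A B : ℤ} (hh : 0 < h) :
    (∃ m n : ℤ, h * m - A + (h * n - B) < h ∧ -2 * (h * m - A) + (h * n - B) < h ∧
      (h * m - A) - 2 * (h * n - B) < h) ∨
    (∃ i j : ℤ, 3 * A = h * (3 * i + 1) ∧ 3 * B = h * (3 * j + 2)) ∨
    (∃ i j : ℤ, 3 * A = h * (3 * i + 2) ∧ 3 * B = h * (3 * j + 1)) := by
  have hA := Int.mul_ediv_add_emod A h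
  have hB := Int.mul_ediv_add_emod B h
  have hr := Int.emod_nonneg A hh.ne'
  have hs := Int.emod_nonneg B hh.ne'
  have hr' := Int.emod_lt_of_pos A hh
  have hs' := Int.emod_lt_of_pos B hh
  generalize A % h = r at *
  generalize B % h = s at *
  generalize A / h = a at *
  generalize B / h = b at *
  subst hA hB
  by_cases h1 : h < r + s
  · exact Or.inl ⟨a + 1, b + 1, by linarith, by linarith, by linarith⟩
  by_cases h2 : 2 * r - s < h ∧ 2 * s - r < h
  · exact Or.inl ⟨a, b, by linarith, by linarith, by linarith⟩
  by_cases h3 : 2 * r - s < h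
  · by_cases h4 : 2 * r < s
    · exact Or.inl ⟨a, b + 1, by linarith, by linarith, by linarith⟩
    · exact Or.inr (Or.inl ⟨a, b, by grind, by grind⟩)
  · by_cases h4 : 2 * s < r
    · exact Or.inl ⟨a + 1, b, by linarith, by linarith, by linarith⟩
    · exact Or.inr (Or.inr ⟨a, b, by grind, by grind⟩)

lemma mem_B10_of_le {x y : ℝ} (h1 : x + y ≤ 1) (h2 : -2 * x + y ≤ 1) (h3 : x - 2 * y ≤ 1) :
    ![x, y, 0] ∈ B10 := by
  have hc : Convex ℝ B10 := convex_convexHull ℝ _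
  have hv : ∀ i, (![![1, 0, 0], ![0, 1, 0], ![-1, -1, 0]] : Fin 3 → Fin 3 → ℝ) i ∈ B10 := by
    intro i
    apply subset_convexHull
    fin_cases i <;> simp
  have := hc.sum_mem (t := Finset.univ)
    (w := ![(1 + 2 * x - y) / 3, (1 - x + 2 * y) / 3, (1 - x - y) / 3])
    (by
      intro i _
      fin_cases i
      · change 0 ≤ (1 + 2 * x - y) / 3
        linarith
      · change 0 ≤ (1 - x + 2 * y) / 3
        linarith
      · change 0 ≤ (1 - x - y) / 3
        linarith)
    (by simp [Fin.sum_univ_three]; ring) (fun i _ => hv i)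
  convert this using 1
  ext i
  fin_cases i <;> simp [Fin.sum_univ_three] <;> ring

lemma apply_two_of_mem_B10 {x : Fin 3 → ℝ} (hx : x ∈ B10) : x 2 = 0 := by
  have hc : Convex ℝ {x : Fin 3 → ℝ | x 2 = 0} :=
    convex_hyperplane (LinearMap.proj (R := ℝ) (φ := fun _ : Fin 3 => ℝ) 2).isLinear 0
  refine convexHull_min ?_ hc hx
  rintro _ (rfl | rfl | rfl) <;> simp

/-- The prism with base `B10` and side `w`. -/
def prismB10 (w : Fin 3 → ℝ) : Set (Fin 3 → ℝ) :=
  convexHull ℝ (B10 ∪ (fun x => x + w) '' B10)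

lemma mem_interior_prismB10 {w x : Fin 3 → ℝ} {h σ : ℝ} (hh : 0 < h) (hσ : σ * σ = 1)
    (hw : w 2 = σ * h) (hx0 : 0 < σ * x 2) (hx1 : σ * x 2 < h)
    (h1 : h * x 0 - σ * x 2 * w 0 + (h * x 1 - σ * x 2 * w 1) < h)
    (h2 : -2 * (h * x 0 - σ * x 2 * w 0) + (h * x 1 - σ * x 2 * w 1) < h)
    (h3 : h * x 0 - σ * x 2 * w 0 - 2 * (h * x 1 - σ * x 2 * w 1) < h) :
    x ∈ interior (prismB10 w) := by
  rw [mem_interior]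
  refine ⟨{x | 0 < σ * x 2 ∧ σ * x 2 < h ∧
    h * x 0 - σ * x 2 * w 0 + (h * x 1 - σ * x 2 * w 1) < h ∧
    -2 * (h * x 0 - σ * x 2 * w 0) + (h * x 1 - σ * x 2 * w 1) < h ∧
    h * x 0 - σ * x 2 * w 0 - 2 * (h * x 1 - σ * x 2 * w 1) < h}, ?_, ?_,
    ⟨hx0, hx1, h1, h2, h3⟩⟩
  · rintro y ⟨hy0, hy1, e1, e2, e3⟩
    obtain ⟨t, ht⟩ : ∃ t, σ * y 2 = h * t := ⟨σ * y 2 / h, by field_simp⟩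
    have hy2 : y 2 = t * w 2 := by
      rw [hw]
      linear_combination σ * ht - y 2 * hσ
    rw [ht] at hy0 hy1 e1 e2 e3
    have hb : ![y 0 - t * w 0, y 1 - t * w 1, 0] ∈ B10 := by
      apply mem_B10_of_le
      · exact le_of_mul_le_mul_left (by linarith) hh
      · exact le_of_mul_le_mul_left (by linarith) hh
      · exact le_of_mul_le_mul_left (by linarith) hh
    have := (convex_convexHull ℝ (B10 ∪ (fun x => x + w) '' B10))
      (subset_convexHull ℝ _ (Or.inl hb))
      (subset_convexHull ℝ _ (Or.inr ⟨_, hb, rfl⟩))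
      (a := 1 - t) (b := t) (by nlinarith) (by nlinarith) (by ring)
    change y ∈ convexHull ℝ _
    convert this using 1
    ext i
    fin_cases i
    · change y 0 = (1 - t) * (y 0 - t * w 0) + t * (y 0 - t * w 0 + w 0)
      ring
    · change y 1 = (1 - t) * (y 1 - t * w 1) + t * (y 1 - t * w 1 + w 1)
      ring
    · change y 2 = (1 - t) * 0 + t * (0 + w 2)
      rw [hy2]
      ring
  · simp only [ofPred_and]
    refine IsOpen.inter ?_ (IsOpen.inter ?_ (IsOpen.inter ?_ (IsOpen.inter ?_ ?_))) <;>
      exact isOpen_lt (by fun_prop) (by fun_prop)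

/-- A bounded set inside a lattice slab is not maximal lattice-free. -/
lemma not_memM3_of_subset_slab {P : Set (Fin 3 → ℝ)} {a : ℤ}
    (hP : P ⊆ {x | x 2 ∈ Icc (a : ℝ) (a + 1)}) : ¬ MemM3 P := by
  rintro ⟨-, hbd, -, -, -, hmax⟩
  have hK : P = {x | x 2 ∈ Icc (a : ℝ) (a + 1)} := by
    apply hmax _ _ _ hP
    · exact (convex_Icc (a : ℝ) (a + 1)).linear_preimage
        (LinearMap.proj (R := ℝ) (φ := fun _ : Fin 3 => ℝ) 2)
    · have := (isOpenMap_eval (X := fun _ : Fin 3 => ℝ) 2).preimage_interior_eq_interior_preimage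
        (continuous_apply 2) (Icc (a : ℝ) ((a : ℝ) + 1))
      rw [show {x : Fin 3 → ℝ | x 2 ∈ Icc (a : ℝ) (a + 1)} =
        Function.eval 2 ⁻¹' Icc (a : ℝ) ((a : ℝ) + 1) from rfl, ← this, interior_Icc]
      rw [eq_empty_iff_forall_notMem]
      rintro x ⟨⟨h1, h2⟩, hx⟩
      obtain ⟨z, hz⟩ := hx 2
      simp only [Function.eval, hz] at h1 h2
      norm_cast at h1 h2
      omega
  obtain ⟨C, hC⟩ := isBounded_iff_forall_norm_le.1 hbd
  have hm : ![C + 1, 0, (a : ℝ)] ∈ P := by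
    rw [hK]
    simp
  have h0 := (norm_le_pi_norm ![C + 1, 0, (a : ℝ)] 0).trans (hC _ hm)
  have h1 := le_abs_self (C + 1)
  simp only [Matrix.cons_val_zero, Real.norm_eq_abs] at h0
  linarith

lemma affMap_image_M10 {U : Matrix (Fin 3) (Fin 3) ℤ} {w : Fin 3 → ℝ}
    (hB : affMap U (fun _ => 0) '' {![1, 0, 0], ![0, 1, 0], ![-1, -1, 0]} =
      {![1, 0, 0], ![0, 1, 0], ![-1, -1, 0]})
    (hw : affMap U (fun _ => 0) ![1, 2, 3] = w) :
    affMap U (fun _ => 0) '' M10 = prismB10 w := by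
  obtain ⟨L, hL⟩ : ∃ L : (Fin 3 → ℝ) →ₗ[ℝ] (Fin 3 → ℝ), affMap U (fun _ => 0) = L := by
    refine ⟨Matrix.toLin' (U.map (fun z : ℤ => (z : ℝ))), ?_⟩
    ext x i
    simp [affMap, Matrix.mulVec, dotProduct]
  rw [hL] at hB hw ⊢
  have hLB : L '' B10 = B10 := by
    rw [B10, L.image_convexHull, hB]
  rw [M10, prismB10, L.image_convexHull, image_union, hLB]
  congr 2
  conv_rhs => rw [← hLB]
  rw [image_image, image_image]
  simp only [map_add, hw]

/-- A maximal lattice-free prism over the triangle `conv{e₁, e₂, -(e₁+e₂)}` is, up to a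
unimodular transformation, the prism `M₁₀`. -/
theorem M3_prism_over_B10 (u : Fin 3 → ℤ) (hu : u 2 ≠ 0) (P : Set (Fin 3 → ℝ))
    (hP : P = convexHull ℝ (B10 ∪ (fun x => x + fun i => (u i : ℝ)) '' B10))
    (hM : MemM3 P) :
    ∃ (U : Matrix (Fin 3) (Fin 3) ℤ) (v : Fin 3 → ℤ),
      |U.det| = 1 ∧ P = affMap U (fun i => (v i : ℝ)) '' M10 := by
  change P = prismB10 _ at hP
  obtain ⟨σ, h, hσ, hh, huσ⟩ : ∃ σ h : ℤ, (σ = 1 ∨ σ = -1) ∧ 0 < h ∧ u 2 = σ * h := by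
    rcases lt_or_gt_of_ne hu with hn | hp
    · exact ⟨-1, -u 2, by simp, by omega, by ring⟩
    · exact ⟨1, u 2, by simp, hp, by ring⟩
  have hσσ : σ * σ = 1 := by rcases hσ with rfl | rfl <;> rfl
  have key : ∀ k : ℤ, 0 < k → k < h →
      (∃ i j : ℤ, 3 * (k * u 0) = h * (3 * i + 1) ∧ 3 * (k * u 1) = h * (3 * j + 2)) ∨
      (∃ i j : ℤ, 3 * (k * u 0) = h * (3 * i + 2) ∧ 3 * (k * u 1) = h * (3 * j + 1)) := by
    intro k hk0 hkh
    refine (exists_int_in_translate_or (A := k * u 0) (B := k * u 1) hh).resolve_left ?_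
    rintro ⟨m, n, e1, e2, e3⟩
    have hk : (σ : ℝ) * (σ * k) = k := by
      rw [← mul_assoc]
      exact_mod_cast by rw [hσσ, one_mul]
    have hmem : ![(m : ℝ), n, σ * k] ∈ interior (prismB10 fun i => (u i : ℝ)) := by
      apply mem_interior_prismB10 (h := h) (σ := σ)
      · exact_mod_cast hh
      · exact_mod_cast hσσ
      · exact_mod_cast huσ
      all_goals
        simp [hk]
        exact_mod_cast (by first | assumption | linarith)
    have hint : ![(m : ℝ), n, σ * k] ∈ intPts 3 := by
      intro i
      fin_cases i
      · exact ⟨m, rfl⟩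
      · exact ⟨n, rfl⟩
      · exact ⟨σ * k, by simp⟩
    have hemp := hM.2.2.2.2.1
    rw [hP] at hemp
    exact (hemp.subset ⟨hmem, hint⟩).elim
  have h1 : h ≠ 1 := by
    rintro rfl
    refine not_memM3_of_subset_slab (P := P) (a := min 0 σ) ?_ hM
    rw [hP]
    refine convexHull_min ?_ ((convex_Icc _ _).linear_preimage
        (LinearMap.proj (R := ℝ) (φ := fun _ : Fin 3 => ℝ) 2))
    rintro _ (hx | ⟨x, hx, rfl⟩)
    · have := apply_two_of_mem_B10 hx
      rcases hσ with rfl | rfl <;> simp [this]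
    · have := apply_two_of_mem_B10 hx
      rcases hσ with rfl | rfl <;> simp [this, huσ]
  have h3 : h = 3 := by
    have k1 := key 1 (by omega) (by omega)
    have h2 : h ≠ 2 := by
      rintro rfl
      rcases k1 with ⟨i, j, e, -⟩ | ⟨i, j, e, -⟩ <;> omega
    by_contra hne
    have k3 := key 3 (by omega) (by omega)
    have hcancel : ∀ a b : ℤ, h * (3 * a) = h * b → 3 * a = b :=
      fun a b e => mul_left_cancel₀ hh.ne' e
    rcases k1 with ⟨i, j, e, -⟩ | ⟨i, j, e, -⟩ <;> rcases k3 with ⟨i', j', e', -⟩ | ⟨i', j', e', -⟩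
    · have := hcancel (3 * i + 1) (3 * i' + 1) (by linarith)
      omega
    · have := hcancel (3 * i + 1) (3 * i' + 2) (by linarith)
      omega
    · have := hcancel (3 * i + 2) (3 * i' + 1) (by linarith)
      omega
    · have := hcancel (3 * i + 2) (3 * i' + 2) (by linarith)
      omega
  subst h3
  rcases key 1 (by norm_num) (by norm_num) with ⟨i, j, e, e'⟩ | ⟨i, j, e, e'⟩
  · have hu0 : u 0 = 3 * i + 1 := by omega
    have hu1 : u 1 = 3 * j + 2 := by omega
    refine ⟨!![1, 0, i; 0, 1, j; 0, 0, σ], 0, ?_, ?_⟩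
    · rcases hσ with rfl | rfl <;> simp [Matrix.det_fin_three]
    · simp only [Pi.zero_apply, Int.cast_zero]
      rw [hP, affMap_image_M10]
      · simp only [image_insert_eq, image_singleton]
        congr 3 <;> ext l <;> fin_cases l <;> simp [affMap, Fin.sum_univ_three]
      · ext l
        fin_cases l <;> simp [affMap, Fin.sum_univ_three, hu0, hu1, huσ] <;> ring
  · have hu0 : u 0 = 3 * i + 2 := by omega
    have hu1 : u 1 = 3 * j + 1 := by omega
    refine ⟨!![0, 1, i; 1, 0, j; 0, 0, σ], 0, ?_, ?_⟩
    · rcases hσ with rfl | rfl <;> simp [Matrix.det_fin_three]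
    · simp only [Pi.zero_apply, Int.cast_zero]
      rw [hP, affMap_image_M10]
      · simp only [image_insert_eq, image_singleton]
        rw [insert_comm]
        congr 3 <;> ext l <;> fin_cases l <;> simp [affMap, Fin.sum_univ_three]
      · ext l
        fin_cases l <;> simp [affMap, Fin.sum_univ_three, hu0, hu1, huσ] <;> ring
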